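/- arXiv:2210.13121 — 2 statements merged into one kernel-verified Lean document; each statement's English description precedes it below -/
import Mathlib

section
/- Let 𝒳 be a Polish space, let P be a Borel probability measure on 𝒳, let X_1, X_2, … be i.i.d. with law P, and let L_{X^n} = (1/n)∑_{i=1}^n δ_{X_i} be the empirical measures, viewed as random elements of the space 𝒫(𝒳) of Borel probability measures equipped with the weak topology. Then the laws of L_{X^n} satisfy the large deviation principle on 𝒫(𝒳) with the good convex rate function Q ↦ D(Q‖P): for every closed F ⊆ 𝒫(𝒳), liminf_{n→∞} −(1/n) log ℙ{L_{X^n} ∈ F} ≥ inf_{Q∈F} D(Q‖P), and for every open G ⊆ 𝒫(𝒳), limsup_{n→∞} −(1/n) log ℙ{L_{X^n} ∈ G} ≤ inf_{Q∈G} D(Q‖P). -/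
open MeasureTheory Filter Topology
open scoped ENNReal NNReal Classical

/-- Relative entropy `D(Q‖P)`: `∫ log (dQ/dP) dQ` if `Q ≪ P` (and the integral is
well-defined), `+∞` otherwise. -/
noncomputable def relEnt {X : Type*} [MeasurableSpace X] (Q P : Measure X) : ℝ≥0∞ :=
  if Q ≪ P ∧ Integrable (llr Q P) Q then ENNReal.ofReal (∫ x, llr Q P x ∂Q) else ⊤

/-- `-(1/n) log p`, as an extended real number. -/
noncomputable def negLogRate (n : ℕ) (p : ℝ≥0∞) : EReal :=
  (-(((n : ℝ)⁻¹ : ℝ) : EReal)) * ENNReal.log p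

/-- The empirical measure `L_{x^n} = (1/n) ∑ δ_{x_i}` of `x : Fin (n+1) → X`, as a Borel
probability measure (an element of `𝒫(X)` with the weak topology). -/
noncomputable def empDist {X : Type*} [MeasurableSpace X] {n : ℕ} (x : Fin (n + 1) → X) :
    ProbabilityMeasure X :=
  ⟨((n + 1 : ℕ) : ℝ≥0∞)⁻¹ • ∑ i, Measure.dirac (x i), by
    constructor
    rw [Measure.smul_apply, Measure.finset_sum_apply]
    simp [ENNReal.inv_mul_cancel]⟩

open InformationTheory ProbabilityTheory
open scoped BoundedContinuousFunction

/-- The functional `Q ↦ ∫ f dQ - ∫ e^f dP + 1`, whose supremum over `f` is the relative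
entropy `D(Q‖P)`. -/
noncomputable def gibbsFunctional {X : Type*} [MeasurableSpace X] (P : Measure X) (f : X → ℝ)
    (Q : Measure X) : ℝ :=
  ∫ x, f x ∂Q - ∫ x, Real.exp (f x) ∂P + 1

lemma relEnt_eq_klDiv {X : Type*} [MeasurableSpace X] (Q P : Measure X)
    [IsProbabilityMeasure Q] [IsProbabilityMeasure P] : relEnt Q P = klDiv Q P := by
  rw [relEnt]
  split_ifs with h
  · rw [klDiv_of_ac_of_integrable h.1 h.2]
    simp
  · exact (klDiv_eq_top_iff.2 fun h1 h2 => h ⟨h1, h2⟩).symm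

lemma mul_sub_exp_add_one_le_klFun {y : ℝ} (hy : 0 ≤ y) (u : ℝ) :
    y * u - Real.exp u + 1 ≤ klFun y := by
  rw [klFun_apply]
  rcases hy.eq_or_lt with rfl | hy
  · simp [Real.exp_nonneg]
  · have h1 := Real.add_one_le_exp (u - Real.log y)
    rw [Real.exp_sub, Real.exp_log hy, le_div_iff₀ hy] at h1
    linarith

section Bounded

variable {X : Type*} [MeasurableSpace X] {P Q : Measure X}

lemma integrable_of_abs_le [IsFiniteMeasure P] {f : X → ℝ} (hf : Measurable f)
    {B : ℝ} (hB : ∀ x, |f x| ≤ B) : Integrable f P :=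
  .of_bound hf.aestronglyMeasurable B (.of_forall hB)

lemma integrable_exp_of_abs_le [IsFiniteMeasure P] {f : X → ℝ} (hf : Measurable f)
    {B : ℝ} (hB : ∀ x, |f x| ≤ B) : Integrable (fun x => Real.exp (f x)) P := by
  refine integrable_of_abs_le (B := Real.exp B) (by fun_prop) fun x => ?_
  rw [Real.abs_exp]
  exact Real.exp_le_exp.2 ((le_abs_self _).trans (hB x))

lemma integrable_rnDeriv_mul_of_abs_le [IsFiniteMeasure Q] {f : X → ℝ} (hf : Measurable f)
    {B : ℝ} (hB : ∀ x, |f x| ≤ B) : Integrable (fun x => (Q.rnDeriv P x).toReal * f x) P :=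
  Measure.integrable_toReal_rnDeriv.mul_bdd hf.aestronglyMeasurable (.of_forall hB)

lemma gibbsFunctional_eq_integral [IsProbabilityMeasure P] [IsProbabilityMeasure Q]
    (hQP : Q ≪ P) {f : X → ℝ} (hf : Measurable f) {B : ℝ} (hB : ∀ x, |f x| ≤ B) :
    gibbsFunctional P f Q
      = ∫ x, ((Q.rnDeriv P x).toReal * f x - Real.exp (f x) + 1) ∂P := by
  have h1 := integrable_rnDeriv_mul_of_abs_le (P := P) (Q := Q) hf hB
  have h2 := integrable_exp_of_abs_le (P := P) hf hB
  have h4 : ∫ x, ((Q.rnDeriv P x).toReal * f x - Real.exp (f x) + 1) ∂P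
      = ∫ x, (Q.rnDeriv P x).toReal * f x ∂P - ∫ x, Real.exp (f x) ∂P + ∫ _, 1 ∂P := by
    rw [← integral_sub h1 h2]
    exact integral_add (h1.sub h2) (integrable_const _)
  have h3 := integral_rnDeriv_smul hQP (f := f)
  simp only [smul_eq_mul] at h3
  rw [h4, h3, gibbsFunctional]
  simp

/-- Gibbs variational inequality. -/
lemma ofReal_gibbsFunctional_le_klDiv [IsProbabilityMeasure P] [IsProbabilityMeasure Q]
    {f : X → ℝ} (hf : Measurable f) {B : ℝ} (hB : ∀ x, |f x| ≤ B) :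
    ENNReal.ofReal (gibbsFunctional P f Q) ≤ klDiv Q P := by
  by_cases htop : klDiv Q P = ⊤
  · simp [htop]
  obtain ⟨hQP, hint⟩ := klDiv_ne_top_iff.1 htop
  refine ENNReal.ofReal_le_of_le_toReal ?_
  rw [toReal_klDiv_eq_integral_klFun hQP, gibbsFunctional_eq_integral hQP hf hB]
  refine integral_mono ?_ ((integrable_klFun_rnDeriv_iff hQP).2 hint) fun x =>
    mul_sub_exp_add_one_le_klFun ENNReal.toReal_nonneg _
  exact ((integrable_rnDeriv_mul_of_abs_le hf hB).sub
    (integrable_exp_of_abs_le hf hB)).add (integrable_const _)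

lemma abs_exp_sub_exp_le {B u v : ℝ} (hu : |u| ≤ B) (hv : |v| ≤ B) :
    |Real.exp u - Real.exp v| ≤ Real.exp B * |u - v| := by
  wlog h : v ≤ u generalizing u v
  · rw [abs_sub_comm, abs_sub_comm u]
    exact this hv hu (le_of_not_ge h)
  have h1 : Real.exp v = Real.exp u * Real.exp (v - u) := by
    rw [← Real.exp_add]; ring_nf
  have h2 := Real.add_one_le_exp (v - u)
  have h3 : Real.exp u ≤ Real.exp B := Real.exp_le_exp.2 ((le_abs_self _).trans hu)
  rw [abs_of_nonneg (sub_nonneg.2 (Real.exp_le_exp.2 h)), abs_of_nonneg (sub_nonneg.2 h)]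
  have h4 := mul_le_mul_of_nonneg_left h2 (Real.exp_nonneg u)
  have h5 := mul_le_mul_of_nonneg_right h3 (sub_nonneg.2 h)
  linarith

lemma absolutelyContinuous_of_forall_gibbsFunctional_le [IsProbabilityMeasure P]
    [IsProbabilityMeasure Q] {c : ℝ}
    (h : ∀ (f : X → ℝ) (B : ℝ), Measurable f → (∀ x, |f x| ≤ B) → gibbsFunctional P f Q ≤ c) :
    Q ≪ P := by
  refine Measure.AbsolutelyContinuous.mk fun s hs hPs => ?_
  by_contra hQs
  have hpos : 0 < Q.real s := by
    rw [Measure.real, ENNReal.toReal_pos_iff]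
    exact ⟨pos_iff_ne_zero.2 hQs, measure_lt_top _ _⟩
  obtain ⟨t, ht0, ht⟩ : ∃ t : ℝ, 0 ≤ t ∧ c < t * Q.real s := by
    refine ⟨(|c| + 1) / Q.real s, by positivity, ?_⟩
    rw [div_mul_cancel₀ _ hpos.ne']
    linarith [le_abs_self c]
  have h1 := h (s.indicator fun _ => t) t (measurable_const.indicator hs) fun x => by
    by_cases hx : x ∈ s <;> simp [hx, abs_of_nonneg ht0, ht0]
  have h2 : ∫ x, Real.exp (s.indicator (fun _ => t) x) ∂P = 1 := by
    rw [integral_congr_ae (g := fun _ => (1 : ℝ))]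
    · simp
    · filter_upwards [measure_eq_zero_iff_ae_notMem.1 hPs] with x hx
      simp [hx]
  rw [gibbsFunctional, h2, integral_indicator_const _ hs, smul_eq_mul] at h1
  linarith

lemma klDiv_le_of_forall_gibbsFunctional_le [IsProbabilityMeasure P]
    [IsProbabilityMeasure Q] {c : ℝ}
    (h : ∀ (f : X → ℝ) (B : ℝ), Measurable f → (∀ x, |f x| ≤ B) → gibbsFunctional P f Q ≤ c) :
    klDiv Q P ≤ ENNReal.ofReal c := by
  have hQP := absolutelyContinuous_of_forall_gibbsFunctional_le h
  let y : X → ℝ := fun x => (Q.rnDeriv P x).toReal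
  have hy : Measurable y := (Measure.measurable_rnDeriv Q P).ennreal_toReal
  have hy0 : ∀ x, 0 ≤ y x := fun x => ENNReal.toReal_nonneg
  let z : ℕ → X → ℝ := fun n x => max (Real.exp (-n)) (min (y x) (Real.exp n))
  have hz : ∀ n, Measurable (z n) := fun n => by fun_prop
  have hzpos : ∀ n x, 0 < z n x := fun n x => lt_max_of_lt_left (Real.exp_pos _)
  let f : ℕ → X → ℝ := fun n x => Real.log (z n x)
  have hf : ∀ n, Measurable (f n) := fun n => (hz n).log
  have hfB : ∀ n x, |f n x| ≤ n := fun n x => by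
    rw [abs_le]
    constructor
    · exact (Real.le_log_iff_exp_le (hzpos n x)).2 (le_max_left _ _)
    · refine (Real.log_le_iff_le_exp (hzpos n x)).2 (max_le ?_ (min_le_right _ _))
      exact Real.exp_le_exp.2 (by linarith [(Nat.cast_nonneg n : (0 : ℝ) ≤ n)])
  let g : ℕ → X → ℝ := fun n x => y x * f n x - Real.exp (f n x) + 1
  have hg : ∀ n, Measurable (g n) := fun n => by fun_prop
  have hexp : ∀ n x, Real.exp (f n x) = z n x := fun n x => Real.exp_log (hzpos n x)
  have hg0 : ∀ n x, 0 ≤ g n x := fun n x => by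
    have h1 := klFun_nonneg (hzpos n x).le
    rw [klFun_apply] at h1
    have h2 : 0 ≤ (y x - z n x) * f n x := by
      rcases le_total (y x) (Real.exp n) with hle | hle
      · rcases le_total (Real.exp (-n)) (y x) with hle' | hle'
        · have : z n x = y x := by simp [z, hle, hle']
          simp [this]
        · have hzx : z n x = Real.exp (-n) := by simp [z, hle, hle']
          have : f n x = -n := by simp [f, hzx]
          rw [this, hzx]
          exact mul_nonneg_of_nonpos_of_nonpos (by linarith) (by simp)
      · have hzx : z n x = Real.exp n := by
          simp only [z, min_eq_right hle]
          exact max_eq_right (Real.exp_le_exp.2 (by linarith [(Nat.cast_nonneg n : (0 : ℝ) ≤ n)]))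
        have : f n x = n := by simp [f, hzx]
        rw [this, hzx]
        exact mul_nonneg (by linarith) (by simp)
    simp only [g, hexp]
    have h3 : f n x = Real.log (z n x) := rfl
    rw [← h3] at h1
    linarith
  have hlim : ∀ x, Tendsto (fun n => g n x) atTop (𝓝 (klFun (y x))) := fun x => by
    have hbot : Tendsto (fun n : ℕ => Real.exp (-(n : ℝ))) atTop (𝓝 0) :=
      Real.tendsto_exp_neg_atTop_nhds_zero.comp tendsto_natCast_atTop_atTop
    have htop : Tendsto (fun n : ℕ => Real.exp (n : ℝ)) atTop atTop :=
      Real.tendsto_exp_atTop.comp tendsto_natCast_atTop_atTop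
    rcases (hy0 x).eq_or_lt with h0 | h0
    · have h1 : Tendsto (fun n : ℕ => - Real.exp (-(n : ℝ)) + 1) atTop (𝓝 (klFun (y x))) := by
        rw [← h0, klFun_zero]
        simpa using hbot.neg.add_const 1
      refine h1.congr fun n => ?_
      simp only [g, hexp, z, ← h0]
      rw [min_eq_left (Real.exp_nonneg _), max_eq_left (Real.exp_nonneg _)]
      ring
    · refine tendsto_const_nhds.congr' ?_
      filter_upwards [hbot.eventually_le_const h0, htop.eventually_ge_atTop (y x)] with n h1 h2
      have hzx : z n x = y x := by simp [z, h1, h2]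
      simp only [g, hexp, f, hzx, klFun_apply]
      ring
  rw [klDiv_eq_lintegral_klFun_of_ac hQP]
  calc ∫⁻ x, ENNReal.ofReal (klFun (y x)) ∂P
      = ∫⁻ x, liminf (fun n => ENNReal.ofReal (g n x)) atTop ∂P := by
        refine lintegral_congr fun x => ?_
        exact ((ENNReal.continuous_ofReal.tendsto _).comp (hlim x)).liminf_eq.symm
    _ ≤ liminf (fun n => ∫⁻ x, ENNReal.ofReal (g n x) ∂P) atTop :=
        lintegral_liminf_le fun n => (hg n).ennreal_ofReal
    _ ≤ liminf (fun _ : ℕ => ENNReal.ofReal c) atTop := by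
        refine liminf_le_liminf (.of_forall fun n => ?_)
        have hint : Integrable (g n) P := ((integrable_rnDeriv_mul_of_abs_le (hf n) (hfB n)).sub
          (integrable_exp_of_abs_le (hf n) (hfB n))).add (integrable_const _)
        rw [← ofReal_integral_eq_lintegral_ofReal hint (.of_forall (hg0 n)),
          ← gibbsFunctional_eq_integral hQP (hf n) (hfB n)]
        exact ENNReal.ofReal_le_ofReal (h _ _ (hf n) (hfB n))
    _ = ENNReal.ofReal c := by simp

end Bounded

section Topological

variable {X : Type*} [MeasurableSpace X] [TopologicalSpace X] [PolishSpace X] [BorelSpace X]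
  {P Q : Measure X}

lemma exists_boundedContinuous_integral_abs_sub_le (μ : Measure X) [IsFiniteMeasure μ]
    {f : X → ℝ} (hf : Measurable f) {B : ℝ} (hB0 : 0 ≤ B) (hB : ∀ x, |f x| ≤ B)
    {ε : ℝ} (hε : 0 < ε) :
    ∃ g : X →ᵇ ℝ, (∀ x, |g x| ≤ B) ∧ ∫ x, |f x - g x| ∂μ ≤ ε := by
  let _ := TopologicalSpace.upgradeIsCompletelyMetrizable X
  have hint : Integrable f μ := integrable_of_abs_le hf hB
  obtain ⟨g, hg, hgi⟩ := hint.exists_boundedContinuous_integral_sub_le hε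
  have hbd : ∀ x, |max (-B) (min (g x) B)| ≤ B := fun x => by
    rw [abs_le]
    exact ⟨le_max_left _ _, max_le (by linarith) (min_le_right _ _)⟩
  let g' : X →ᵇ ℝ := BoundedContinuousFunction.ofNormedAddCommGroup
    (fun x => max (-B) (min (g x) B)) (by fun_prop) B hbd
  refine ⟨g', hbd, le_trans (integral_mono ?_ (hint.sub hgi).norm fun x => ?_) hg⟩
  · exact (hint.sub (integrable_of_abs_le g'.continuous.measurable hbd)).abs
  · change |f x - max (-B) (min (g x) B)| ≤ |f x - g x|
    have hfx := abs_le.1 (hB x)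
    rcases le_total (g x) B with h1 | h1
    · rcases le_total (-B) (g x) with h2 | h2
      · simp [h1, h2]
      · rw [min_eq_left h1, max_eq_left h2, abs_of_nonneg (by linarith),
          abs_of_nonneg (by linarith)]
        linarith
    · rw [min_eq_right h1, max_eq_right (by linarith), abs_of_nonpos (by linarith),
        abs_of_nonpos (by linarith)]
      linarith

lemma gibbsFunctional_le_of_forall_boundedContinuous [IsProbabilityMeasure P]
    [IsProbabilityMeasure Q] {c : ℝ} (h : ∀ g : X →ᵇ ℝ, gibbsFunctional P g Q ≤ c)
    {f : X → ℝ} (hf : Measurable f) {B : ℝ} (hB : ∀ x, |f x| ≤ B) :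
    gibbsFunctional P f Q ≤ c := by
  obtain ⟨x₀⟩ : Nonempty X := Q.nonempty_of_neZero
  have hB0 : 0 ≤ B := (abs_nonneg _).trans (hB x₀)
  refine le_of_forall_pos_le_add fun ε hε => ?_
  have hδ : 0 < 1 + Real.exp B := by positivity
  obtain ⟨g, hgB, hg⟩ := exists_boundedContinuous_integral_abs_sub_le (P + Q) hf hB0 hB
    (div_pos hε hδ)
  have hgm : Measurable g := g.continuous.measurable
  have hP : Integrable (fun x => |f x - g x|) P :=
    ((integrable_of_abs_le hf hB).sub (integrable_of_abs_le hgm hgB)).abs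
  have hQ : Integrable (fun x => |f x - g x|) Q :=
    ((integrable_of_abs_le hf hB).sub (integrable_of_abs_le hgm hgB)).abs
  rw [integral_add_measure hP hQ, le_div_iff₀ hδ] at hg
  have h1 : ∫ x, f x ∂Q - ∫ x, g x ∂Q ≤ ∫ x, |f x - g x| ∂Q := by
    rw [← integral_sub (integrable_of_abs_le hf hB) (integrable_of_abs_le hgm hgB)]
    exact integral_mono ((integrable_of_abs_le hf hB).sub (integrable_of_abs_le hgm hgB)) hQ
      fun x => le_abs_self _
  have h2 : ∫ x, Real.exp (g x) ∂P - ∫ x, Real.exp (f x) ∂P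
      ≤ Real.exp B * ∫ x, |f x - g x| ∂P := by
    rw [← integral_sub (integrable_exp_of_abs_le hgm hgB) (integrable_exp_of_abs_le hf hB),
      ← integral_const_mul]
    refine integral_mono ((integrable_exp_of_abs_le hgm hgB).sub
      (integrable_exp_of_abs_le hf hB)) (hP.const_mul _) fun x => ?_
    have := abs_exp_sub_exp_le (hgB x) (hB x)
    rw [abs_sub_comm (g x)] at this
    exact (le_abs_self _).trans this
  have h3 := h g
  have h4 : 0 ≤ ∫ x, |f x - g x| ∂P := integral_nonneg fun _ => abs_nonneg _
  have h5 : 0 ≤ ∫ x, |f x - g x| ∂Q := integral_nonneg fun _ => abs_nonneg _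
  have h6 := mul_nonneg (Real.exp_nonneg B) h5
  unfold gibbsFunctional at h3 ⊢
  nlinarith

/-- Variational characterisation of the sublevel sets of the relative entropy. -/
lemma klDiv_le_iff_forall_boundedContinuous [IsProbabilityMeasure P] [IsProbabilityMeasure Q]
    {c : ℝ≥0∞} :
    klDiv Q P ≤ c ↔ ∀ g : X →ᵇ ℝ, ENNReal.ofReal (gibbsFunctional P g Q) ≤ c := by
  refine ⟨fun h g => (ofReal_gibbsFunctional_le_klDiv g.continuous.measurable
    g.norm_coe_le_norm).trans h, fun h => ?_⟩
  by_cases hc : c = ⊤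
  · simp [hc]
  rw [← ENNReal.ofReal_toReal hc]
  refine klDiv_le_of_forall_gibbsFunctional_le fun f B hf hB =>
    gibbsFunctional_le_of_forall_boundedContinuous (fun g => ?_) hf hB
  have := h g
  rwa [ENNReal.ofReal_le_iff_le_toReal hc] at this

omit [PolishSpace X] in
lemma continuous_gibbsFunctional (P : Measure X) (g : X →ᵇ ℝ) :
    Continuous fun Q : ProbabilityMeasure X => gibbsFunctional P g (Q : Measure X) := by
  have : Continuous fun Q : ProbabilityMeasure X => ∫ x, g x ∂(Q : Measure X) :=
    continuous_iff_continuousAt.2 fun Q =>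
      ProbabilityMeasure.tendsto_iff_forall_integral_tendsto.1 tendsto_id g
  unfold gibbsFunctional
  fun_prop

lemma isClosed_setOf_klDiv_le (P : Measure X) [IsProbabilityMeasure P] (c : ℝ≥0∞) :
    IsClosed {Q : ProbabilityMeasure X | klDiv (Q : Measure X) P ≤ c} := by
  simp only [klDiv_le_iff_forall_boundedContinuous, Set.ofPred_forall]
  exact isClosed_iInter fun g => isClosed_le
    (ENNReal.continuous_ofReal.comp (continuous_gibbsFunctional P g)) continuous_const

lemma relEnt_convex_combination_le (P Q₁ Q₂ : Measure X) [IsProbabilityMeasure P]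
    [IsProbabilityMeasure Q₁] [IsProbabilityMeasure Q₂] {t : ℝ≥0} (ht : t ≤ 1) :
    relEnt ((t : ℝ≥0∞) • Q₁ + ((1 - t : ℝ≥0) : ℝ≥0∞) • Q₂) P
      ≤ (t : ℝ≥0∞) * relEnt Q₁ P + ((1 - t : ℝ≥0) : ℝ≥0∞) * relEnt Q₂ P := by
  have : IsProbabilityMeasure ((t : ℝ≥0∞) • Q₁ + ((1 - t : ℝ≥0) : ℝ≥0∞) • Q₂) := by
    constructor
    simp only [Measure.add_apply, Measure.smul_apply, measure_univ, smul_eq_mul, mul_one]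
    rw [← ENNReal.coe_add, add_tsub_cancel_of_le ht, ENNReal.coe_one]
  rw [relEnt_eq_klDiv, relEnt_eq_klDiv, relEnt_eq_klDiv, klDiv_le_iff_forall_boundedContinuous]
  intro g
  have hg : ∀ (μ : Measure X) [IsFiniteMeasure μ], Integrable g μ := fun μ _ => g.integrable μ
  have key : gibbsFunctional P g ((t : ℝ≥0∞) • Q₁ + ((1 - t : ℝ≥0) : ℝ≥0∞) • Q₂)
      = t * gibbsFunctional P g Q₁ + (1 - t : ℝ≥0) * gibbsFunctional P g Q₂ := by
    unfold gibbsFunctional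
    rw [integral_add_measure ((hg Q₁).smul_measure ENNReal.coe_ne_top)
      ((hg Q₂).smul_measure ENNReal.coe_ne_top), integral_smul_measure, integral_smul_measure]
    simp only [ENNReal.coe_toReal, smul_eq_mul, NNReal.coe_sub ht, NNReal.coe_one]
    ring
  rw [key]
  refine ENNReal.ofReal_add_le.trans ?_
  rw [ENNReal.ofReal_mul t.coe_nonneg, ENNReal.ofReal_mul (1 - t : ℝ≥0).coe_nonneg]
  simp only [ENNReal.ofReal_coe_nnreal]
  have h1 := klDiv_le_iff_forall_boundedContinuous.1 (le_refl (klDiv Q₁ P)) g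
  have h2 := klDiv_le_iff_forall_boundedContinuous.1 (le_refl (klDiv Q₂ P)) g
  gcongr

end Topological

section Empirical

variable {X : Type*} [MeasurableSpace X] {P Q : Measure X} {n : ℕ}

lemma integral_empDist (x : Fin (n + 1) → X) {f : X → ℝ} (hf : Measurable f) :
    ∫ y, f y ∂(empDist x : Measure X) = ((n : ℝ) + 1)⁻¹ * ∑ i, f (x i) := by
  change ∫ y, f y ∂(((n + 1 : ℕ) : ℝ≥0∞)⁻¹ • ∑ i, Measure.dirac (x i)) = _
  rw [integral_smul_measure, integral_finsetSum_measure fun i _ =>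
    integrable_dirac' hf.stronglyMeasurable (by simp)]
  simp [integral_dirac' _ _ hf.stronglyMeasurable, -Nat.cast_add]
  simp

lemma lintegral_pi_prod {ι : Type*} [Fintype ι] [IsProbabilityMeasure P] {f : ι → X → ℝ≥0∞}
    (hf : ∀ i, Measurable (f i)) :
    ∫⁻ x, ∏ i, f i (x i) ∂(Measure.pi fun _ : ι => P) = ∏ i, ∫⁻ y, f i y ∂P := by
  have hind : iIndepFun (fun i (x : ι → X) => f i (x i)) (Measure.pi fun _ : ι => P) :=
    iIndepFun_pi fun i => (hf i).aemeasurable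
  have h := lintegral_prod_eq_prod_lintegral_of_indepFun Finset.univ
    (fun i (x : ι → X) => f i (x i)) hind fun i => (hf i).comp (measurable_pi_apply i)
  rw [h]
  exact Finset.prod_congr rfl fun i _ =>
    (measurePreserving_eval (fun _ : ι => P) i).lintegral_comp (hf i)

/-- Exponential Chebyshev inequality for empirical measures. -/
lemma pi_le_gibbsFunctional_le [IsProbabilityMeasure P] {f : X → ℝ} (hf : Measurable f)
    {B : ℝ} (hB : ∀ x, |f x| ≤ B) (a : ℝ) :
    (Measure.pi fun _ : Fin (n + 1) => P) {x | a ≤ gibbsFunctional P f (empDist x : Measure X)}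
      ≤ ENNReal.ofReal (Real.exp (-((n + 1) * a))) := by
  set m := ∫ x, Real.exp (f x) ∂P with hm
  let h : X → ℝ≥0∞ := fun y => ENNReal.ofReal (Real.exp (f y - (m - 1) - a))
  have hmeas : Measurable h := by fun_prop
  have hprod : ∀ x : Fin (n + 1) → X, ∏ i, h (x i)
      = ENNReal.ofReal (Real.exp (∑ i, f (x i) - (n + 1) * (m - 1 + a))) := fun x => by
    rw [← ENNReal.ofReal_prod_of_nonneg fun _ _ => Real.exp_nonneg _, ← Real.exp_sum,
      Finset.sum_sub_distrib, Finset.sum_sub_distrib]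
    congr 2
    simp
    ring
  have hsub : {x : Fin (n + 1) → X | a ≤ gibbsFunctional P f (empDist x : Measure X)}
      ⊆ {x | 1 ≤ ∏ i, h (x i)} := fun x hx => by
    rw [Set.mem_ofPred_eq, gibbsFunctional, integral_empDist x hf, ← hm] at hx
    have hn : (0 : ℝ) < n + 1 := by positivity
    rw [Set.mem_ofPred_eq, hprod, ENNReal.one_le_ofReal, Real.one_le_exp_iff]
    have h1 : (n + 1) * (m - 1 + a) ≤ (n + 1) * (((n : ℝ) + 1)⁻¹ * ∑ i, f (x i)) :=
      mul_le_mul_of_nonneg_left (by linarith) hn.le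
    rw [mul_inv_cancel_left₀ hn.ne'] at h1
    linarith
  have hone : ∫⁻ y, h y ∂P ≤ ENNReal.ofReal (Real.exp (-a)) := by
    have h1 : ∀ y, Real.exp (f y - (m - 1) - a) = Real.exp (f y) * Real.exp (-(m - 1) - a) :=
      fun y => by rw [← Real.exp_add]; ring_nf
    have hint := (integrable_exp_of_abs_le (P := P) hf hB).mul_const (Real.exp (-(m - 1) - a))
    simp only [h, h1]
    rw [← ofReal_integral_eq_lintegral_ofReal hint (.of_forall fun y => by positivity),
      integral_mul_const, ← hm]
    refine ENNReal.ofReal_le_ofReal ?_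
    have h2 := Real.add_one_le_exp (m - 1)
    rw [sub_add_cancel] at h2
    calc m * Real.exp (-(m - 1) - a) ≤ Real.exp (m - 1) * Real.exp (-(m - 1) - a) := by gcongr
      _ = Real.exp (-a) := by rw [← Real.exp_add]; ring_nf
  calc _ ≤ (Measure.pi fun _ : Fin (n + 1) => P) {x | 1 ≤ ∏ i, h (x i)} := measure_mono hsub
    _ ≤ ∫⁻ x, ∏ i, h (x i) ∂(Measure.pi fun _ : Fin (n + 1) => P) := by
        have := mul_meas_ge_le_lintegral (μ := Measure.pi fun _ : Fin (n + 1) => P)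
          (f := fun x => ∏ i, h (x i))
          (Finset.measurable_prod _ fun i _ => hmeas.comp (measurable_pi_apply i)) 1
        simpa using this
    _ = (∫⁻ y, h y ∂P) ^ (n + 1) := by
        rw [lintegral_pi_prod fun _ => hmeas]
        simp
    _ ≤ ENNReal.ofReal (Real.exp (-a)) ^ (n + 1) := by gcongr
    _ = _ := by
        rw [← ENNReal.ofReal_pow (Real.exp_nonneg _), ← Real.exp_nat_mul]
        congr 2
        push_cast
        ring

end Empirical

lemma le_negLogRate {n : ℕ} {p : ℝ≥0∞} {a : ℝ}
    (h : p ≤ ENNReal.ofReal (Real.exp (-((n + 1) * a)))) :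
    (a : EReal) ≤ negLogRate (n + 1) p := by
  have hn : (0 : ℝ) < n + 1 := by positivity
  have hlog := ENNReal.log_le_log h
  rw [ENNReal.log_ofReal_of_pos (Real.exp_pos _), Real.log_exp] at hlog
  rw [negLogRate]
  generalize ENNReal.log p = L at hlog
  induction L with
  | bot =>
    rw [← EReal.coe_neg, EReal.coe_mul_bot_of_neg (by push_cast; simpa using hn)]
    exact le_top
  | top => exact absurd (top_le_iff.1 hlog) (EReal.coe_ne_top _)
  | coe r =>
    rw [← EReal.coe_neg, ← EReal.coe_mul, EReal.coe_le_coe_iff]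
    have hr : r ≤ -((n + 1) * a) := by exact_mod_cast hlog
    push_cast
    rw [neg_mul, inv_mul_eq_div, ← neg_div, le_div_iff₀ hn]
    linarith

lemma negLogRate_le {n : ℕ} {p : ℝ≥0∞} {a : ℝ}
    (h : ENNReal.ofReal (Real.exp (-((n + 1) * a))) ≤ p) :
    negLogRate (n + 1) p ≤ (a : EReal) := by
  have hn : (0 : ℝ) < n + 1 := by positivity
  have hlog := ENNReal.log_le_log h
  rw [ENNReal.log_ofReal_of_pos (Real.exp_pos _), Real.log_exp] at hlog
  rw [negLogRate]
  generalize ENNReal.log p = L at hlog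
  induction L with
  | top =>
    rw [← EReal.coe_neg, EReal.coe_mul_top_of_neg (by push_cast; simpa using hn)]
    exact bot_le
  | bot => exact absurd (le_bot_iff.1 hlog) (EReal.coe_ne_bot _)
  | coe r =>
    rw [← EReal.coe_neg, ← EReal.coe_mul, EReal.coe_le_coe_iff]
    have hr : -((n + 1) * a) ≤ r := by exact_mod_cast hlog
    push_cast
    rw [neg_mul, inv_mul_eq_div, ← neg_div, div_le_iff₀ hn]
    linarith

section UpperBound

variable {X : Type*} [MeasurableSpace X] [TopologicalSpace X] [PolishSpace X] [BorelSpace X]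

/-- A compact set of probability measures outside which countably many Gibbs functionals
detect a large value. -/
lemma exists_isCompact_forall_notMem_le_gibbsFunctional (P : Measure X)
    [IsProbabilityMeasure P] {M : ℝ} (hM : 0 ≤ M) :
    ∃ (K : Set (ProbabilityMeasure X)) (f : ℕ → X → ℝ) (B : ℕ → ℝ), IsCompact K ∧
      (∀ k, Measurable (f k)) ∧ (∀ k x, |f k x| ≤ B k) ∧
      ∀ Q : ProbabilityMeasure X, Q ∉ K → ∃ k : ℕ, k + M + 1 ≤ gibbsFunctional P (f k) Q := by
  let l : ℕ → ℝ := fun k => (k + 1) * (k + M + 2)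
  have hl : ∀ k, 0 ≤ l k := fun k => by positivity
  have htight := isTightMeasureSet_iff_exists_isCompact_measure_compl_le.1
    (isTightMeasureSet_singleton (μ := P))
  have hex : ∀ k, ∃ C : Set X, IsCompact C ∧ P Cᶜ ≤ ENNReal.ofReal (Real.exp (-l k)) :=
    fun k => by
      obtain ⟨C, hC, hP⟩ := htight (ENNReal.ofReal (Real.exp (-l k)))
        (ENNReal.ofReal_pos.2 (Real.exp_pos _))
      exact ⟨C, hC, hP P rfl⟩
  choose C hC hP using hex
  have hCm : ∀ k, MeasurableSet (C k)ᶜ := fun k => (hC k).measurableSet.compl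
  let u : ℕ → ℝ≥0 := fun k => 1 / ((k : ℝ≥0) + 1)
  have hu : Tendsto u atTop (𝓝 0) := tendsto_one_div_add_atTop_nhds_zero_nat
  let f : ℕ → X → ℝ := fun k => (C k)ᶜ.indicator fun _ => l k
  have hf : ∀ k, Measurable (f k) := fun k => measurable_const.indicator (hCm k)
  have hfB : ∀ k x, |f k x| ≤ l k := fun k x => by
    by_cases hx : x ∈ (C k)ᶜ
    · simp [f, Set.indicator_of_mem hx, abs_of_nonneg (hl k)]
    · simp [f, Set.indicator_of_notMem hx, hl k]
  have hnorm : NormalSpace X := by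
    let _ := TopologicalSpace.upgradeIsCompletelyMetrizable X
    infer_instance
  refine ⟨{Q | ∀ k, Q (C k)ᶜ ≤ u k}, f, l,
    isCompact_setOfPred_probabilityMeasure_mass_eq_compl_isCompact_le hu hC (.inl hnorm),
    hf, hfB, fun Q hQ => ?_⟩
  simp only [Set.mem_ofPred_eq, not_forall, not_le] at hQ
  obtain ⟨k, hk⟩ := hQ
  refine ⟨k, ?_⟩
  have hkR : (1 : ℝ) / (k + 1) ≤ (Q : Measure X).real (C k)ᶜ := by
    have : (u k : ℝ) ≤ (Q (C k)ᶜ : ℝ) := by exact_mod_cast hk.le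
    simpa [u] using this
  have hPk : P.real (C k)ᶜ ≤ Real.exp (-l k) :=
    ENNReal.toReal_le_of_le_ofReal (Real.exp_nonneg _) (hP k)
  have hexp : ∀ x, Real.exp (f k x) = 1 + (C k)ᶜ.indicator (fun _ => Real.exp (l k) - 1) x :=
    fun x => by
      by_cases hx : x ∈ (C k)ᶜ
      · simp only [f, Set.indicator_of_mem hx]; ring
      · simp only [f, Set.indicator_of_notMem hx, Real.exp_zero, add_zero]
  have hintP : ∫ x, Real.exp (f k x) ∂P = 1 + P.real (C k)ᶜ * (Real.exp (l k) - 1) := by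
    simp only [hexp]
    rw [integral_add (integrable_const _) ((integrable_const _).indicator (hCm k)),
      integral_indicator_const _ (hCm k)]
    simp
  have hintQ : ∫ x, f k x ∂(Q : Measure X) = (Q : Measure X).real (C k)ᶜ * l k :=
    integral_indicator_const _ (hCm k)
  have h1 : (k : ℝ) + M + 2 ≤ (Q : Measure X).real (C k)ᶜ * l k := by
    calc (k : ℝ) + M + 2 = 1 / (k + 1) * l k := by simp only [l]; field_simp
      _ ≤ _ := mul_le_mul_of_nonneg_right hkR (hl k)
  have h2 : P.real (C k)ᶜ * (Real.exp (l k) - 1) ≤ 1 := by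
    calc P.real (C k)ᶜ * (Real.exp (l k) - 1) ≤ Real.exp (-l k) * Real.exp (l k) := by
          gcongr
          · linarith [Real.one_le_exp (hl k)]
          · linarith
      _ = 1 := by rw [← Real.exp_add]; simp
  rw [gibbsFunctional, hintP, hintQ]
  linarith

lemma isCompact_setOf_klDiv_le (P : Measure X) [IsProbabilityMeasure P] {c : ℝ≥0∞}
    (hc : c ≠ ⊤) : IsCompact {Q : ProbabilityMeasure X | klDiv (Q : Measure X) P ≤ c} := by
  obtain ⟨K, f, B, hK, hf, hB, h⟩ :=
    exists_isCompact_forall_notMem_le_gibbsFunctional P (M := c.toReal) ENNReal.toReal_nonneg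
  refine hK.of_isClosed_subset (isClosed_setOf_klDiv_le P c) fun Q hQ => ?_
  by_contra hQK
  obtain ⟨k, hk⟩ := h Q hQK
  have h1 := (ofReal_gibbsFunctional_le_klDiv (P := P) (Q := Q) (hf k) (hB k)).trans hQ
  rw [ENNReal.ofReal_le_iff_le_toReal hc] at h1
  have : (0 : ℝ) ≤ k := k.cast_nonneg
  linarith

/-- Exponential tightness of the laws of the empirical measures. -/
lemma exists_isCompact_pi_notMem_le (P : Measure X) [IsProbabilityMeasure P]
    {M : ℝ} (hM : 0 ≤ M) :
    ∃ K : Set (ProbabilityMeasure X), IsCompact K ∧ ∀ n : ℕ,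
      (Measure.pi fun _ : Fin (n + 1) => P) {x | empDist x ∉ K}
        ≤ ENNReal.ofReal (Real.exp (-((n + 1) * M))) := by
  obtain ⟨K, f, B, hK, hf, hB, h⟩ := exists_isCompact_forall_notMem_le_gibbsFunctional P hM
  refine ⟨K, hK, fun n => ?_⟩
  have hsub : {x : Fin (n + 1) → X | empDist x ∉ K}
      ⊆ ⋃ k : ℕ, {x | k + M + 1 ≤ gibbsFunctional P (f k) (empDist x : Measure X)} :=
    fun x hx => Set.mem_iUnion.2 (h _ hx)
  have hterm : ∀ k : ℕ, Real.exp (-((n + 1) * (k + M + 1)))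
      ≤ Real.exp (-((n + 1) * M)) * (2⁻¹ ^ (k + 1)) := fun k => by
    have h2 : Real.exp (-1) ≤ 2⁻¹ := by
      rw [Real.exp_neg]
      exact inv_anti₀ two_pos (by linarith [Real.add_one_le_exp 1])
    calc Real.exp (-((n + 1) * (k + M + 1)))
        ≤ Real.exp (-((n + 1) * M) + (k + 1 : ℕ) * (-1)) := by
          refine Real.exp_le_exp.2 ?_
          push_cast
          have : (0 : ℝ) ≤ n * (k + 1) := by positivity
          linarith
      _ = Real.exp (-((n + 1) * M)) * Real.exp (-1) ^ (k + 1) := by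
          rw [Real.exp_add, Real.exp_nat_mul]
      _ ≤ _ := by gcongr
  calc _ ≤ ∑' k : ℕ, (Measure.pi fun _ : Fin (n + 1) => P)
        {x | k + M + 1 ≤ gibbsFunctional P (f k) (empDist x : Measure X)} :=
        (measure_mono hsub).trans (measure_iUnion_le _)
    _ ≤ ∑' k : ℕ, ENNReal.ofReal (Real.exp (-((n + 1) * M))) * 2⁻¹ ^ (k + 1) := by
        refine ENNReal.tsum_le_tsum fun k => (pi_le_gibbsFunctional_le (hf k) (hB k) _).trans ?_
        refine (ENNReal.ofReal_le_ofReal (hterm k)).trans_eq ?_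
        rw [ENNReal.ofReal_mul (Real.exp_nonneg _), ENNReal.ofReal_pow (by norm_num),
          ENNReal.ofReal_inv_of_pos two_pos, ENNReal.ofReal_ofNat]
    _ = _ := by
        rw [ENNReal.tsum_mul_left, ENNReal.tsum_geometric_add_one]
        simp [ENNReal.inv_mul_cancel]

lemma exists_forall_pi_mem_le (P : Measure X) [IsProbabilityMeasure P]
    {F : Set (ProbabilityMeasure X)} (hF : IsClosed F) {a : ℝ} (ha : 0 ≤ a)
    (h : ∀ Q ∈ F, ENNReal.ofReal a < klDiv (Q : Measure X) P) :
    ∃ N : ℕ, ∀ n : ℕ, (Measure.pi fun _ : Fin (n + 1) => P) {x | empDist x ∈ F}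
      ≤ N * ENNReal.ofReal (Real.exp (-((n + 1) * a))) := by
  obtain ⟨K, hK, hKP⟩ := exists_isCompact_pi_notMem_le P ha
  obtain ⟨t, ht⟩ := (hK.inter_left hF).elim_finite_subcover
    (fun g : X →ᵇ ℝ => {Q : ProbabilityMeasure X | a < gibbsFunctional P g (Q : Measure X)})
    (fun g => isOpen_lt continuous_const (continuous_gibbsFunctional P g)) fun Q hQ => by
      have hQF := h Q hQ.1
      contrapose! hQF
      refine klDiv_le_iff_forall_boundedContinuous.2 fun g => ENNReal.ofReal_le_ofReal ?_
      simp only [Set.mem_iUnion, not_exists, Set.mem_ofPred_eq, not_lt] at hQF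
      exact hQF g
  refine ⟨t.card + 1, fun n => ?_⟩
  have hsub : {x : Fin (n + 1) → X | empDist x ∈ F} ⊆ {x | empDist x ∉ K}
      ∪ ⋃ g ∈ t, {x | a ≤ gibbsFunctional P g (empDist x : Measure X)} := fun x hx => by
    by_cases hxK : empDist x ∈ K
    · right
      obtain ⟨g, hg, hxg⟩ := Set.mem_iUnion₂.1 (ht ⟨hx, hxK⟩)
      exact Set.mem_iUnion₂.2 ⟨g, hg, (show a < gibbsFunctional P g _ from hxg).le⟩
    · exact .inl hxK
  calc _ ≤ _ + _ := (measure_mono hsub).trans (measure_union_le _ _)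
    _ ≤ ENNReal.ofReal (Real.exp (-((n + 1) * a)))
        + ∑ _g ∈ t, ENNReal.ofReal (Real.exp (-((n + 1) * a))) := by
        refine add_le_add (hKP n) ((measure_biUnion_finset_le _ _).trans ?_)
        exact Finset.sum_le_sum fun g _ =>
          pi_le_gibbsFunctional_le g.continuous.measurable g.norm_coe_le_norm a
    _ = _ := by
        rw [Finset.sum_const, nsmul_eq_mul]
        push_cast
        ring

lemma iInf_klDiv_le_liminf (P : Measure X) [IsProbabilityMeasure P]
    {F : Set (ProbabilityMeasure X)} (hF : IsClosed F) :
    ((⨅ Q ∈ F, klDiv (Q : Measure X) P : ℝ≥0∞) : EReal)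
      ≤ liminf (fun n : ℕ => negLogRate (n + 1)
          ((Measure.pi fun _ : Fin (n + 1) => P) {x | empDist x ∈ F})) atTop := by
  refine EReal.ge_of_forall_gt_iff_ge.1 fun b hb => ?_
  refine le_liminf_of_le (by isBoundedDefault) ?_
  rcases lt_or_ge b 0 with hb0 | hb0
  · refine .of_forall fun n => le_negLogRate (prob_le_one.trans ?_)
    rw [ENNReal.one_le_ofReal, Real.one_le_exp_iff]
    nlinarith [(Nat.cast_nonneg n : (0 : ℝ) ≤ n)]
  obtain ⟨a, hba, ha⟩ := EReal.lt_iff_exists_real_btwn.1 hb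
  rw [EReal.coe_lt_coe_iff] at hba
  have ha0 : 0 ≤ a := hb0.trans hba.le
  obtain ⟨N, hN⟩ := exists_forall_pi_mem_le P hF ha0 fun Q hQ => by
    rw [← EReal.coe_ennreal_lt_coe_ennreal_iff, EReal.coe_ennreal_ofReal, max_eq_left ha0]
    exact ha.trans_le (EReal.coe_ennreal_le_coe_ennreal_iff.2 (iInf₂_le Q hQ))
  have hlim : Tendsto (fun n : ℕ => Real.exp (((n : ℝ) + 1) * (a - b))) atTop atTop :=
    Real.tendsto_exp_atTop.comp ((tendsto_natCast_atTop_atTop.atTop_add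
      tendsto_const_nhds).atTop_mul_const (sub_pos.2 hba))
  filter_upwards [hlim.eventually_ge_atTop (N : ℝ)] with n hn
  refine le_negLogRate ((hN n).trans ?_)
  rw [← ENNReal.ofReal_natCast, ← ENNReal.ofReal_mul (Nat.cast_nonneg N)]
  refine ENNReal.ofReal_le_ofReal ?_
  calc (N : ℝ) * Real.exp (-((n + 1) * a))
      ≤ Real.exp ((n + 1) * (a - b)) * Real.exp (-((n + 1) * a)) := by gcongr
    _ = _ := by rw [← Real.exp_add]; ring_nf

end UpperBound

section LowerBound

section Measurable

variable {X : Type*} [MeasurableSpace X] {P Q : Measure X}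

lemma pi_eq_withDensity_prod_rnDeriv {ι : Type*} [Fintype ι] [IsProbabilityMeasure P]
    [IsProbabilityMeasure Q] (hQP : Q ≪ P) :
    (Measure.pi fun _ : ι => Q)
      = (Measure.pi fun _ : ι => P).withDensity fun x => ∏ i, Q.rnDeriv P (x i) := by
  refine Measure.pi_eq fun s hs => ?_
  have hind : ∀ x : ι → X, (Set.univ.pi s).indicator (fun x => ∏ i, Q.rnDeriv P (x i)) x
      = ∏ i, (s i).indicator (Q.rnDeriv P) (x i) := fun x => by
    by_cases hx : x ∈ Set.univ.pi s
    · rw [Set.indicator_of_mem hx]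
      exact Finset.prod_congr rfl fun i _ => (Set.indicator_of_mem (hx i trivial) _).symm
    · rw [Set.indicator_of_notMem hx]
      obtain ⟨i, hi⟩ : ∃ i, x i ∉ s i := by simpa using hx
      exact (Finset.prod_eq_zero (Finset.mem_univ i) (Set.indicator_of_notMem hi _)).symm
  rw [withDensity_apply _ (MeasurableSet.univ_pi hs),
    ← lintegral_indicator (MeasurableSet.univ_pi hs)]
  simp only [hind]
  rw [lintegral_pi_prod fun i => (Measure.measurable_rnDeriv Q P).indicator (hs i)]
  refine Finset.prod_congr rfl fun i _ => ?_
  rw [lintegral_indicator (hs i), Measure.setLIntegral_rnDeriv hQP]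

lemma pi_inter_prod_rnDeriv_le {ι : Type*} [Fintype ι] [IsProbabilityMeasure P]
    [IsProbabilityMeasure Q] (hQP : Q ≪ P) (S : Set (ι → X)) (C : ℝ≥0∞) :
    (Measure.pi fun _ : ι => Q) (S ∩ {x | ∏ i, Q.rnDeriv P (x i) ≤ C})
      ≤ C * (Measure.pi fun _ : ι => P) S := by
  rw [pi_eq_withDensity_prod_rnDeriv hQP, withDensity_apply']
  calc _ ≤ ∫⁻ _ in S ∩ {x | ∏ i, Q.rnDeriv P (x i) ≤ C}, C ∂(Measure.pi fun _ : ι => P) :=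
        setLIntegral_mono measurable_const fun x hx => hx.2
    _ ≤ _ := by
        rw [setLIntegral_const]
        gcongr
        exact Set.inter_subset_left

/-- Strong law of large numbers along the coordinates of an infinite product. -/
lemma ae_tendsto_average_infinitePi [IsProbabilityMeasure Q] {g : X → ℝ} (hg : Measurable g)
    (hint : Integrable g Q) :
    ∀ᵐ ω ∂(Measure.infinitePi fun _ : ℕ => Q),
      Tendsto (fun n : ℕ => ((n : ℝ) + 1)⁻¹ * ∑ i : Fin (n + 1), g (ω i)) atTop
        (𝓝 (∫ x, g x ∂Q)) := by
  have hmp := fun i => measurePreserving_eval_infinitePi (fun _ : ℕ => Q) i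
  have hslln := strong_law_ae_real (μ := Measure.infinitePi fun _ : ℕ => Q)
    (fun i ω => g (ω i)) ((hmp 0).integrable_comp_of_integrable hint)
    (fun i j hij => (iIndepFun_infinitePi (X := fun _ => g) fun _ => hg).indepFun hij)
    (fun i => ⟨(hg.comp (hmp i).measurable).aemeasurable,
      (hg.comp (hmp 0).measurable).aemeasurable, by
        change Measure.map (g ∘ (Function.eval i : (ℕ → X) → X)) _
          = Measure.map (g ∘ (Function.eval 0 : (ℕ → X) → X)) _
        rw [← Measure.map_map hg (hmp i).measurable, ← Measure.map_map hg (hmp 0).measurable,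
          (hmp i).map_eq, (hmp 0).map_eq]⟩)
  have hmean : ∫ ω, g (ω 0) ∂(Measure.infinitePi fun _ : ℕ => Q) = ∫ x, g x ∂Q := by
    have h := integral_map (hmp 0).measurable.aemeasurable
      (hg.aestronglyMeasurable (μ := Measure.map _ (Measure.infinitePi fun _ : ℕ => Q)))
    rw [(hmp 0).map_eq] at h
    exact h.symm
  filter_upwards [hslln] with ω hω
  rw [hmean] at hω
  refine ((tendsto_add_atTop_iff_nat 1).2 hω).congr fun n => ?_
  rw [Finset.sum_range, div_eq_inv_mul]
  push_cast
  rfl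

lemma pi_ge_of_ae_eventually [IsProbabilityMeasure Q] {S : (n : ℕ) → Set (Fin (n + 1) → X)}
    (hS : ∀ᵐ ω ∂(Measure.infinitePi fun _ : ℕ => Q),
      ∀ᶠ n : ℕ in atTop, (fun i : Fin (n + 1) => ω i) ∈ S n) {η : ℝ≥0∞} (hη : η < 1) :
    ∀ᶠ n : ℕ in atTop, η ≤ (Measure.pi fun _ : Fin (n + 1) => Q) (S n) := by
  set μ := Measure.infinitePi fun _ : ℕ => Q
  let E : ℕ → Set (ℕ → X) := fun n => {ω | ∀ m ≥ n, (fun i : Fin (m + 1) => ω i) ∈ S m}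
  have hmono : Monotone E := fun n n' hn ω hω m hm => hω m (hn.trans hm)
  have hU : μ (⋃ n, E n) = 1 := by
    rw [← measure_univ (μ := μ)]
    refine measure_congr (eventuallyEq_univ.2 ?_)
    filter_upwards [hS] with ω hω
    obtain ⟨n, hn⟩ := eventually_atTop.1 hω
    exact Set.mem_iUnion.2 ⟨n, hn⟩
  have hlim : Tendsto (fun n => μ (E n)) atTop (𝓝 (μ (⋃ n, E n))) :=
    tendsto_measure_iUnion_atTop hmono
  rw [hU] at hlim
  filter_upwards [hlim.eventually_const_le hη] with n hn
  have hmap : μ.map (fun ω (i : Fin (n + 1)) => ω i) = Measure.pi fun _ : Fin (n + 1) => Q := by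
    rw [← Measure.infinitePi_eq_pi]
    exact Measure.map_infinitePi_infinitePi_of_inj (P := fun _ : ℕ => Q) Fin.val_injective
  calc η ≤ μ (E n) := hn
    _ ≤ μ ((fun ω (i : Fin (n + 1)) => ω i) ⁻¹' S n) := measure_mono fun ω hω => hω n le_rfl
    _ ≤ _ := by
        rw [← hmap]
        exact Measure.le_map_apply
          (measurable_pi_lambda _ fun i => measurable_pi_apply _).aemeasurable _

lemma ae_eventually_prod_rnDeriv_le [IsProbabilityMeasure P] [IsProbabilityMeasure Q]
    (hQP : Q ≪ P) (hint : Integrable (llr Q P) Q) {ε : ℝ} (hε : 0 < ε) :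
    ∀ᵐ ω ∂(Measure.infinitePi fun _ : ℕ => Q), ∀ᶠ n : ℕ in atTop,
      ∏ i : Fin (n + 1), Q.rnDeriv P (ω i)
        ≤ ENNReal.ofReal (Real.exp ((n + 1) * (∫ x, llr Q P x ∂Q + ε))) := by
  have hpos : ∀ᵐ x ∂Q, Q.rnDeriv P x = ENNReal.ofReal (Real.exp (llr Q P x)) := by
    filter_upwards [Measure.rnDeriv_pos hQP, hQP.ae_le (Measure.rnDeriv_lt_top Q P)]
      with x h0 htop
    rw [llr, Real.exp_log (ENNReal.toReal_pos h0.ne' htop.ne), ENNReal.ofReal_toReal htop.ne]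
  have hall : ∀ᵐ ω ∂(Measure.infinitePi fun _ : ℕ => Q), ∀ i,
      Q.rnDeriv P (ω i) = ENNReal.ofReal (Real.exp (llr Q P (ω i))) :=
    ae_all_iff.2 fun i =>
      (measurePreserving_eval_infinitePi (fun _ : ℕ => Q) i).quasiMeasurePreserving.ae hpos
  filter_upwards [hall, ae_tendsto_average_infinitePi (measurable_llr Q P) hint] with ω hω hlim
  filter_upwards [hlim.eventually_le_const (lt_add_of_pos_right _ hε)] with n hn
  simp only [hω]
  rw [← ENNReal.ofReal_prod_of_nonneg fun _ _ => Real.exp_nonneg _, ← Real.exp_sum]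
  rw [inv_mul_le_iff₀ (by positivity)] at hn
  exact ENNReal.ofReal_le_ofReal (Real.exp_le_exp.2 hn)

end Measurable

variable {X : Type*} [MeasurableSpace X] [TopologicalSpace X] [PolishSpace X] [BorelSpace X]

omit [PolishSpace X] in
lemma ae_eventually_empDist_mem (Q : ProbabilityMeasure X) {G : Set (ProbabilityMeasure X)}
    (hG : G ∈ 𝓝 Q) :
    ∀ᵐ ω ∂(Measure.infinitePi fun _ : ℕ => (Q : Measure X)),
      ∀ᶠ n : ℕ in atTop, empDist (fun i : Fin (n + 1) => ω i) ∈ G := by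
  have hlim : Tendsto (fun p : (ℕ → X) × ℕ => empDist fun i : Fin (p.2 + 1) => p.1 i)
      ((ae (Measure.infinitePi fun _ : ℕ => (Q : Measure X))).curry atTop) (𝓝 Q) := by
    refine ProbabilityMeasure.tendsto_iff_forall_integral_tendsto.2 fun f => ?_
    have hf : Measurable f := f.continuous.measurable
    refine tendsto_def.2 fun s hs => eventually_curry_iff.2 ?_
    filter_upwards [ae_tendsto_average_infinitePi hf (f.integrable (Q : Measure X))] with ω hω
    filter_upwards [hω hs] with n hn
    rw [integral_empDist _ hf]
    exact hn
  exact eventually_curry_iff.1 (hlim.eventually_mem hG)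

omit [PolishSpace X] in
lemma limsup_negLogRate_le_relEnt (P : Measure X) [IsProbabilityMeasure P]
    {G : Set (ProbabilityMeasure X)} {Q : ProbabilityMeasure X} (hG : G ∈ 𝓝 Q) :
    limsup (fun n : ℕ => negLogRate (n + 1)
        ((Measure.pi fun _ : Fin (n + 1) => P) {x | empDist x ∈ G})) atTop
      ≤ (relEnt (Q : Measure X) P : EReal) := by
  rw [relEnt]
  split_ifs with h
  swap
  · exact le_top
  obtain ⟨hQP, hint⟩ := h
  set d := ∫ x, llr (Q : Measure X) P x ∂(Q : Measure X)
  refine EReal.le_of_forall_lt_iff_le.1 fun z hz => ?_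
  have hdz : d < z := by
    rw [EReal.coe_ennreal_ofReal, EReal.coe_lt_coe_iff] at hz
    exact (le_max_left _ _).trans_lt hz
  refine limsup_le_of_le (by isBoundedDefault) ?_
  set ε := (z - d) / 2 with hεdef
  have hε : 0 < ε := by rw [hεdef]; linarith
  have hzε : z = d + ε + ε := by rw [hεdef]; ring
  have hη : ENNReal.ofReal (Real.exp (-ε)) < 1 := by
    rw [ENNReal.ofReal_lt_one, Real.exp_lt_one_iff]
    linarith
  have hev := pi_ge_of_ae_eventually (Q := (Q : Measure X))
    (S := fun n => {x | empDist x ∈ G} ∩ {x | ∏ i, (Q : Measure X).rnDeriv P (x i)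
      ≤ ENNReal.ofReal (Real.exp ((n + 1) * (d + ε)))}) (by
        filter_upwards [ae_eventually_empDist_mem Q hG,
          ae_eventually_prod_rnDeriv_le hQP hint hε] with ω h1 h2
        filter_upwards [h1, h2] with n h3 h4
        exact ⟨h3, h4⟩) hη
  filter_upwards [hev] with n hn
  have hle := hn.trans (pi_inter_prod_rnDeriv_le hQP _ _)
  refine negLogRate_le ?_
  calc ENNReal.ofReal (Real.exp (-((n + 1) * z)))
      ≤ ENNReal.ofReal (Real.exp (-((n + 1) * (d + ε))) * Real.exp (-ε)) := by
        refine ENNReal.ofReal_le_ofReal ?_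
        rw [← Real.exp_add, hzε]
        refine Real.exp_le_exp.2 ?_
        have : 0 ≤ (n : ℝ) * ε := by positivity
        linarith
    _ ≤ ENNReal.ofReal (Real.exp (-((n + 1) * (d + ε))))
        * (ENNReal.ofReal (Real.exp ((n + 1) * (d + ε)))
          * (Measure.pi fun _ : Fin (n + 1) => P) {x | empDist x ∈ G}) := by
        rw [ENNReal.ofReal_mul (Real.exp_nonneg _)]
        gcongr
    _ = _ := by
        rw [← mul_assoc, ← ENNReal.ofReal_mul (Real.exp_nonneg _), ← Real.exp_add]
        simp

omit [PolishSpace X] in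
lemma limsup_negLogRate_le_iInf (P : Measure X) [IsProbabilityMeasure P]
    {G : Set (ProbabilityMeasure X)} (hG : IsOpen G) :
    limsup (fun n : ℕ => negLogRate (n + 1)
        ((Measure.pi fun _ : Fin (n + 1) => P) {x | empDist x ∈ G})) atTop
      ≤ ((⨅ Q ∈ G, relEnt (Q : Measure X) P : ℝ≥0∞) : EReal) := by
  refine le_of_forall_gt fun z hz => ?_
  obtain ⟨w, hw, hwz⟩ := EReal.lt_iff_exists_real_btwn.1 hz
  have hw0 : 0 ≤ w := by
    have := (EReal.coe_ennreal_nonneg _).trans hw.le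
    exact_mod_cast this
  rw [← max_eq_left hw0, ← EReal.coe_ennreal_ofReal,
    EReal.coe_ennreal_lt_coe_ennreal_iff] at hw
  simp only [iInf_lt_iff] at hw
  obtain ⟨Q, hQ, hQw⟩ := hw
  refine (limsup_negLogRate_le_relEnt P (hG.mem_nhds hQ)).trans_lt (lt_trans ?_ hwz)
  rw [← max_eq_left hw0, ← EReal.coe_ennreal_ofReal]
  exact EReal.coe_ennreal_lt_coe_ennreal_iff.2 hQw

end LowerBound

/-- **Sanov's theorem.** For a Polish space `X` and i.i.d. samples from `P`, the laws of the
empirical measures satisfy the LDP on `𝒫(X)` (with the weak topology) with the good convex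
rate function `Q ↦ D(Q‖P)`: lower bound on closed sets, upper bound on open sets; moreover
the rate function has compact sublevel sets (goodness) and is convex. -/
theorem sanov {X : Type*} [MeasurableSpace X] [TopologicalSpace X] [PolishSpace X]
    [BorelSpace X] (P : Measure X) [IsProbabilityMeasure P] :
    (∀ F : Set (ProbabilityMeasure X), IsClosed F →
      ((⨅ Q ∈ F, relEnt (Q : Measure X) P : ℝ≥0∞) : EReal)
        ≤ liminf (fun n : ℕ =>
            negLogRate (n + 1)
              ((Measure.pi fun _ : Fin (n + 1) => P) {x | empDist x ∈ F})) atTop)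
    ∧ (∀ G : Set (ProbabilityMeasure X), IsOpen G →
      limsup (fun n : ℕ =>
          negLogRate (n + 1)
            ((Measure.pi fun _ : Fin (n + 1) => P) {x | empDist x ∈ G})) atTop
        ≤ ((⨅ Q ∈ G, relEnt (Q : Measure X) P : ℝ≥0∞) : EReal))
    ∧ (∀ c : ℝ≥0∞, c ≠ ⊤ →
      IsCompact {Q : ProbabilityMeasure X | relEnt (Q : Measure X) P ≤ c})
    ∧ (∀ Q₁ Q₂ : Measure X, IsProbabilityMeasure Q₁ → IsProbabilityMeasure Q₂ →
      ∀ t : ℝ≥0, t ≤ 1 →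
        relEnt ((t : ℝ≥0∞) • Q₁ + ((1 - t : ℝ≥0) : ℝ≥0∞) • Q₂) P
          ≤ (t : ℝ≥0∞) * relEnt Q₁ P + ((1 - t : ℝ≥0) : ℝ≥0∞) * relEnt Q₂ P) := by
  refine ⟨fun F hF => ?_, fun G hG => limsup_negLogRate_le_iInf P hG, fun c hc => ?_,
    fun Q₁ Q₂ _ _ t ht => relEnt_convex_combination_le P Q₁ Q₂ ht⟩
  · simp only [relEnt_eq_klDiv]
    exact iInf_klDiv_le_liminf P hF
  · simp only [relEnt_eq_klDiv]
    exact isCompact_setOf_klDiv_le P hc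
end

section
/- Let 𝒳 be a Polish space, let Q be a Borel probability measure on 𝒳, let X_1, X_2, … be i.i.d. with law Q, and let L_{X^n} = (1/n)∑_{i=1}^n δ_{X_i}. Then for every ε > 0, liminf_{n→∞} −(1/n) log Q^{⊗n}{ x^n : d_P(L_{x^n}, Q) ≥ ε } ≥ ε²/2, where d_P is the Lévy–Prokhorov metric. -/
open MeasureTheory Filter Topology
open scoped ENNReal NNReal Classical

/-- The empirical measure `L_{x^n} = (1/n) ∑ δ_{x_i}` of `x : Fin (n+1) → X`. -/
noncomputable def empMeas {X : Type*} [MeasurableSpace X] {n : ℕ} (x : Fin n → X) :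
    Measure X :=
  (n : ℝ≥0∞)⁻¹ • ∑ i, Measure.dirac (x i)

/-- Some finite family of measurable sets controls the Lévy–Prokhorov distance to `Q`. -/
theorem exists_finset_levyProkhorovEDist_lt {X : Type*} [MeasurableSpace X] [MetricSpace X]
    [PolishSpace X] [BorelSpace X] (Q : Measure X) [IsProbabilityMeasure Q] {ε : ℝ} (hε : 0 < ε) :
    ∃ F : Finset (Set X), (∀ S ∈ F, MeasurableSet S) ∧
      ∀ μ : Measure X, IsProbabilityMeasure μ → (∀ S ∈ F, μ.real S ≤ Q.real S + ε / 2) →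
        levyProkhorovEDist μ Q < ENNReal.ofReal ε := by
  obtain ⟨K, hK, hKQ⟩ : ∃ K : Set X, IsCompact K ∧ Q Kᶜ ≤ ENNReal.ofReal (ε / 4) := by
    have := isTightMeasureSet_iff_exists_isCompact_measure_compl_le.1
      (isTightMeasureSet_singleton (μ := Q)) (ENNReal.ofReal (ε / 4)) (by positivity)
    simpa using this
  obtain ⟨t, -, ht, hKt⟩ := hK.finite_cover_balls (e := ε / 4) (by positivity)
  lift t to Finset X using ht
  let A : Finset X → Set X := fun I => ⋃ z ∈ I, Metric.ball z (ε / 4)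
  have hA (I : Finset X) : MeasurableSet (A I) :=
    (isOpen_biUnion fun _ _ => Metric.isOpen_ball).measurableSet
  have hKQ' : Q.real Kᶜ ≤ ε / 4 := by
    rw [measureReal_def]
    exact ENNReal.toReal_le_of_le_ofReal (by positivity) hKQ
  refine ⟨t.powerset.image (fun I => A I ∪ Kᶜ) ∪ t.powerset.image (fun I => (A I)ᶜ), ?_, ?_⟩
  · intro S hS
    simp only [Finset.mem_union, Finset.mem_image] at hS
    obtain ⟨I, -, rfl⟩ | ⟨I, -, rfl⟩ := hS
    · exact (hA I).union hK.measurableSet.compl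
    · exact (hA I).compl
  intro μ hμ h
  refine lt_of_le_of_lt (b := ENNReal.ofReal (3 * ε / 4)) (sInf_le fun B _ => ?_)
    ((ENNReal.ofReal_lt_ofReal_iff hε).2 (by linarith))
  rw [ENNReal.toReal_ofReal (by positivity)]
  let I := t.filter fun z => (Metric.ball z (ε / 4) ∩ B).Nonempty
  have hBA : B ⊆ A I ∪ Kᶜ := by
    intro y hy
    by_cases hyK : y ∈ K
    · obtain ⟨z, hz, hyz⟩ := Set.mem_iUnion₂.1 (hKt hyK)
      exact Or.inl (Set.mem_iUnion₂.2 ⟨z, Finset.mem_filter.2 ⟨hz, y, hyz, hy⟩, hyz⟩)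
    · exact Or.inr hyK
  have hAB : A I ⊆ Metric.thickening (3 * ε / 4) B := by
    intro y hy
    obtain ⟨z, hz, hyz⟩ := Set.mem_iUnion₂.1 hy
    obtain ⟨-, w, hwz, hwB⟩ := Finset.mem_filter.1 hz
    refine Metric.mem_thickening_iff.2 ⟨w, hwB, ?_⟩
    have := dist_triangle_right y w z
    rw [Metric.mem_ball] at hyz hwz
    linarith
  have hIt : I ∈ t.powerset := Finset.mem_powerset.2 (Finset.filter_subset _ _)
  have h1 := h _ (Finset.mem_union_left _ (Finset.mem_image_of_mem _ hIt))
  have h2 := h _ (Finset.mem_union_right _ (Finset.mem_image_of_mem _ hIt))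
  rw [probReal_compl_eq_one_sub (hA I), probReal_compl_eq_one_sub (hA I)] at h2
  have key (ν₁ ν₂ : Measure X) [IsProbabilityMeasure ν₁] [IsProbabilityMeasure ν₂]
      (hν : ν₁.real B ≤ ν₂.real (Metric.thickening (3 * ε / 4) B) + 3 * ε / 4) :
      ν₁ B ≤ ν₂ (Metric.thickening (3 * ε / 4) B) + ENNReal.ofReal (3 * ε / 4) := by
    rw [← ofReal_measureReal (μ := ν₁), ← ofReal_measureReal (μ := ν₂),
      ← ENNReal.ofReal_add measureReal_nonneg (by positivity)]
    exact ENNReal.ofReal_le_ofReal hν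
  have hu := measureReal_union_le (μ := Q) (A I) Kᶜ
  constructor
  · apply key
    have := measureReal_mono (μ := μ) hBA
    have := measureReal_mono (μ := Q) hAB
    linarith
  · apply key
    have := measureReal_mono (μ := Q) hBA
    have := measureReal_mono (μ := μ) hAB
    linarith

theorem isProbabilityMeasure_empMeas {X : Type*} [MeasurableSpace X] {n : ℕ} (hn : n ≠ 0)
    (x : Fin n → X) : IsProbabilityMeasure (empMeas x) where
  measure_univ := by
    simp [empMeas, ENNReal.inv_mul_cancel (Nat.cast_ne_zero.2 hn) (ENNReal.natCast_ne_top n)]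

theorem empMeas_real_apply {X : Type*} [MeasurableSpace X] {n : ℕ} (x : Fin n → X) {S : Set X}
    (hS : MeasurableSet S) :
    (empMeas x).real S = (n : ℝ)⁻¹ * ∑ i, S.indicator (fun _ => (1 : ℝ)) (x i) := by
  have h (i : Fin n) : S.indicator (1 : X → ℝ≥0∞) (x i) ≠ ∞ := by
    by_cases hi : x i ∈ S <;> simp [hi]
  simp only [measureReal_def, empMeas, Measure.smul_apply, Measure.finsetSum_apply,
    Measure.dirac_apply' _ hS, smul_eq_mul, ENNReal.toReal_mul, ENNReal.toReal_inv,
    ENNReal.toReal_natCast, ENNReal.toReal_sum fun i _ => h i]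
  congr 1
  refine Finset.sum_congr rfl fun i _ => ?_
  by_cases hi : x i ∈ S <;> simp [hi]

/-- Hoeffding's inequality for the empirical frequency of a measurable set. -/
theorem pi_add_lt_empMeas_real_le {X : Type*} [MeasurableSpace X] (Q : Measure X)
    [IsProbabilityMeasure Q] {n : ℕ} (hn : n ≠ 0) {S : Set X} (hS : MeasurableSet S) {t : ℝ}
    (ht : 0 ≤ t) :
    (Measure.pi fun _ : Fin n => Q) {x | Q.real S + t < (empMeas x).real S} ≤
      ENNReal.ofReal (Real.exp (-2 * n * t ^ 2)) := by
  have hn' : (0 : ℝ) < n := by positivity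
  let Y : X → ℝ := S.indicator fun _ => 1
  have hY : Measurable Y := measurable_const.indicator hS
  have hYQ : ∫ y, Y y ∂Q = Q.real S := by simp [Y, integral_indicator hS]
  have hind := ProbabilityTheory.iIndepFun_pi (μ := fun _ : Fin n => Q)
    (X := fun _ y => Y y - Q.real S) fun _ => (hY.sub_const _).aemeasurable
  have hsub (i : Fin n) : ProbabilityTheory.HasSubgaussianMGF
      (fun x : Fin n → X => Y (x i) - Q.real S) ((‖(1 : ℝ) - 0‖₊ / 2) ^ 2)
      (Measure.pi fun _ : Fin n => Q) := by
    have h := ProbabilityTheory.hasSubgaussianMGF_of_mem_Icc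
      (μ := Measure.pi fun _ : Fin n => Q) (X := fun x => Y (x i)) (a := 0) (b := 1)
      (hY.comp (measurable_pi_apply i)).aemeasurable (ae_of_all _ fun x => by
        by_cases hi : x i ∈ S <;> simp [Y, hi])
    rwa [integral_comp_eval (μ := fun _ : Fin n => Q) hY.aestronglyMeasurable, hYQ] at h
  have hoeff := ProbabilityTheory.HasSubgaussianMGF.measure_sum_ge_le_of_iIndepFun hind
    (s := Finset.univ) (fun i _ => hsub i) (ε := n * t) (by positivity)
  have hexp : -(n * t) ^ 2 / (2 * ((∑ _i : Fin n, (‖(1 : ℝ) - 0‖₊ / 2) ^ 2 : ℝ≥0) : ℝ)) =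
      -2 * n * t ^ 2 := by
    simp
    field_simp
  rw [hexp] at hoeff
  refine (measure_mono fun x hx => ?_).trans
    ((ENNReal.le_ofReal_iff_toReal_le (measure_ne_top _ _) (by positivity)).2 hoeff)
  have hx : Q.real S + t < (empMeas x).real S := hx
  rw [empMeas_real_apply x hS, ← div_eq_inv_mul, lt_div_iff₀ hn'] at hx
  simp only [Set.mem_ofPred_eq, Finset.sum_sub_distrib, Finset.sum_const, Finset.card_univ,
    Fintype.card_fin, nsmul_eq_mul]
  change _ < ∑ i, Y (x i) at hx
  linarith

/-- The rate `-(1/n) log p` when `p ≤ C exp (-n a)`. -/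
theorem sub_le_negLogRate {n : ℕ} (hn : n ≠ 0) {p : ℝ≥0∞} {a C : ℝ} (hC : 0 < C)
    (hp : p ≤ ENNReal.ofReal (C * Real.exp (-n * a))) :
    ((a - Real.log C / n : ℝ) : EReal) ≤ negLogRate n p := by
  have hn' : (0 : ℝ) < n := by positivity
  have hlog := ENNReal.log_le_log hp
  rw [ENNReal.log_ofReal_of_pos (by positivity), Real.log_mul hC.ne' (Real.exp_ne_zero _),
    Real.log_exp] at hlog
  have h : (((n : ℝ)⁻¹ : ℝ) : EReal) * ENNReal.log p ≤
      (((n : ℝ)⁻¹ : ℝ) : EReal) * ((Real.log C + -n * a : ℝ) : EReal) :=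
    mul_le_mul_of_nonneg_left hlog (EReal.coe_nonneg.2 (by positivity))
  rw [negLogRate, EReal.neg_mul, EReal.le_neg]
  refine h.trans (le_of_eq ?_)
  rw [← EReal.coe_mul, ← EReal.coe_neg]
  congr 1
  field_simp
  ring

/-- **Concentration of empirical measures in the Lévy–Prokhorov metric.** For a Polish
(metric) space `X`, i.i.d. samples from `Q`, and every `ε > 0`,
`liminf_n -(1/n) log Q^{⊗n}{ x^n : d_P(L_{x^n}, Q) ≥ ε } ≥ ε²/2`. -/
theorem empirical_LP_concentration {X : Type*} [MeasurableSpace X] [MetricSpace X]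
    [PolishSpace X] [BorelSpace X] (Q : Measure X) [IsProbabilityMeasure Q] :
    ∀ ε : ℝ, 0 < ε →
      ((ε ^ 2 / 2 : ℝ) : EReal) ≤ liminf (fun n : ℕ =>
        negLogRate (n + 1)
          ((Measure.pi fun _ : Fin (n + 1) => Q)
            {x | ENNReal.ofReal ε ≤ levyProkhorovEDist (empMeas x) Q})) atTop := by
  intro ε hε
  obtain ⟨F, hF, hFε⟩ := exists_finset_levyProkhorovEDist_lt Q hε
  have hC : (0 : ℝ) < F.card + 1 := by positivity
  have hbound (n : ℕ) : (Measure.pi fun _ : Fin (n + 1) => Q)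
      {x | ENNReal.ofReal ε ≤ levyProkhorovEDist (empMeas x) Q} ≤
      ENNReal.ofReal ((F.card + 1) * Real.exp (-(n + 1 : ℕ) * (ε ^ 2 / 2))) := by
    calc _ ≤ (Measure.pi fun _ : Fin (n + 1) => Q)
          (⋃ S ∈ F, {x | Q.real S + ε / 2 < (empMeas x).real S}) := by
          refine measure_mono fun x hx => ?_
          by_contra hcon
          simp only [Set.mem_iUnion, Set.mem_ofPred_eq, not_exists, not_lt] at hcon
          exact (hFε _ (isProbabilityMeasure_empMeas n.succ_ne_zero x) hcon).not_ge hx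
      _ ≤ ∑ S ∈ F, (Measure.pi fun _ : Fin (n + 1) => Q)
          {x | Q.real S + ε / 2 < (empMeas x).real S} := measure_biUnion_finset_le _ _
      _ ≤ ∑ S ∈ F, ENNReal.ofReal (Real.exp (-(n + 1 : ℕ) * (ε ^ 2 / 2))) := by
          refine Finset.sum_le_sum fun S hS => ?_
          refine (pi_add_lt_empMeas_real_le Q n.succ_ne_zero (hF S hS) (by positivity)).trans_eq ?_
          congr 2
          ring
      _ ≤ _ := by
          rw [Finset.sum_const, nsmul_eq_mul, ENNReal.ofReal_mul hC.le, ← ENNReal.ofReal_natCast]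
          gcongr
          linarith
  have hlim : Tendsto (fun n : ℕ =>
      ((ε ^ 2 / 2 - Real.log (F.card + 1) / (n + 1 : ℕ) : ℝ) : EReal)) atTop
      (𝓝 ((ε ^ 2 / 2 : ℝ) : EReal)) := by
    refine (continuous_coe_real_ereal.tendsto _).comp ?_
    simpa using ((tendsto_const_div_atTop_nhds_zero_nat (Real.log (F.card + 1))).comp
      (tendsto_add_atTop_nat 1)).const_sub (ε ^ 2 / 2)
  rw [← hlim.liminf_eq]
  exact liminf_le_liminf (Eventually.of_forall fun n =>
    sub_le_negLogRate n.succ_ne_zero hC (hbound n))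
end
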